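/- Consider the driven quenched sandpile model on I_n = {0,1,…,n} with the fixed toppling environment ζ given by ζ(0) = r and ζ(x) = s for all 1 ≤ x ≤ n. Let η_f be the configuration with η_f(x) = 1 for all x ∈ I_n, and η_e the configuration with η_e(x) = 1 for x < n and η_e(n) = 0. Then for every η ∈ {η_f, η_e} and every addition site a ∈ I_n, adding one particle at a and stabilizing yields: if n − a is odd, the configuration η itself; if n − a is even, the other element of {η_f, η_e}. In particular the set {η_f, η_e} is absorbing. -/

import Mathlib

/-- Toppling labels: `r` (both particles to the right neighbor) and
`s` (one particle to each neighbor). -/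
inductive Label : Type
  | r : Label
  | s : Label
deriving DecidableEq

namespace Driven

variable (n : ℕ)

/-- One toppling at site `x` of the interval `I_n = {0, …, n}` in environment `ζ`:
site `x` loses two particles; if `ζ x = r` both go to `x + 1`, and if `ζ x = s`
one goes to each of `x - 1` and `x + 1`; particles sent outside `I_n` are lost. -/
def topple (ζ : Fin (n + 1) → Label) (η : Fin (n + 1) → ℕ) (x : Fin (n + 1)) :
    Fin (n + 1) → ℕ := fun y =>
  (η y - if y = x then 2 else 0)
    + (if ζ x = Label.r ∧ (y : ℕ) = (x : ℕ) + 1 then 2 else 0)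
    + (if ζ x = Label.s ∧ (y : ℕ) + 1 = (x : ℕ) then 1 else 0)
    + (if ζ x = Label.s ∧ (y : ℕ) = (x : ℕ) + 1 then 1 else 0)

/-- A legal toppling: some unstable site (height `≥ 2`) topples. -/
def LegalStep (ζ : Fin (n + 1) → Label) (η η' : Fin (n + 1) → ℕ) : Prop :=
  ∃ x, 2 ≤ η x ∧ η' = topple n ζ η x

/-- A configuration is stable when every height is at most `1`. -/
def Stable (η : Fin (n + 1) → ℕ) : Prop := ∀ x, η x ≤ 1

/-- `η` stabilizes to `ξ`: `ξ` is stable and reachable from `η` by finitely many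
legal topplings. -/
def StabilizesTo (ζ : Fin (n + 1) → Label) (η ξ : Fin (n + 1) → ℕ) : Prop :=
  Relation.ReflTransGen (LegalStep n ζ) η ξ ∧ Stable n ξ

/-- Addition of one particle at site `a`. -/
def addAt (a : Fin (n + 1)) (η : Fin (n + 1) → ℕ) : Fin (n + 1) → ℕ :=
  Function.update η a (η a + 1)

/-- The full configuration `η_f ≡ 1`. -/
def etaF : Fin (n + 1) → ℕ := fun _ => 1

/-- The non-full configuration `η_e`: height `1` everywhere except height `0` at
the rightmost site `n`. -/
def etaE : Fin (n + 1) → ℕ := fun x => if (x : ℕ) = n then 0 else 1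

end Driven

namespace Driven

/-- The number of particles received by site `y` when each site `k` topples `f k` times and
only site `0` carries the label `r`. -/
def inflow (f : ℕ → ℕ) (y : ℕ) : ℕ :=
  (if y = 0 then 0 else if y = 1 then 2 * f 0 else f (y - 1)) + f (y + 1)

/-- No nonzero toppling vector `f` can be undone from `η` leaving every site of its support
stable. -/
def NoForbidden (n : ℕ) (η : Fin (n + 1) → ℕ) : Prop :=
  ∀ f : ℕ → ℕ, (∀ y, n < y → f y = 0) → (∃ y, 0 < f y) →
    ∃ y : Fin (n + 1), 0 < f y ∧ inflow f y + 2 ≤ η y + 2 * f y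

variable {n : ℕ} {ζ : Fin (n + 1) → Label} {η ξ : Fin (n + 1) → ℕ}

theorem NoForbidden.topple (hζ0 : ζ 0 = Label.r) (hζ : ∀ x, x ≠ 0 → ζ x = Label.s)
    (h : NoForbidden n η) {x : Fin (n + 1)} (hx : 2 ≤ η x) :
    NoForbidden n (topple n ζ η x) := by
  intro f hf hpos
  have hlab : (ζ x = Label.r ↔ (x : ℕ) = 0) ∧ (ζ x = Label.s ↔ (x : ℕ) ≠ 0) := by
    by_cases h0 : x = 0
    · subst h0; simp [hζ0]
    · have : (x : ℕ) ≠ 0 := fun h => h0 (Fin.ext h)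
      simp [hζ x h0, this]
  have hxn := x.isLt
  by_cases hfx : f x = 0
  · obtain ⟨y, hy, hle⟩ := h f hf hpos
    have hyx : y ≠ x := by rintro rfl; omega
    refine ⟨y, hy, ?_⟩
    simp only [Driven.topple, hyx, if_false]
    omega
  · let g : ℕ → ℕ := fun k => if k = x then f k - 1 else f k
    by_cases hg : ∃ y, 0 < g y
    · obtain ⟨y, hy, hle⟩ := h g
        (fun y hy => by simp only [g]; split_ifs <;> simp [hf y hy]) hg
      have hyn := y.isLt
      refine ⟨y, ?_, ?_⟩
      · simp only [g] at hy
        split_ifs at hy <;> omega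
      · simp only [Driven.topple, hlab.1, hlab.2, Fin.ext_iff]
        by_cases hyx : y = x
        · subst hyx
          simp only [inflow, g] at hle ⊢
          split_ifs at hle ⊢ <;> grind
        · have hyx' : (y : ℕ) ≠ x := fun h => hyx (Fin.ext h)
          simp only [inflow, g] at hle ⊢
          split_ifs at hle ⊢ <;> grind
    · have hz : ∀ k, k ≠ (x : ℕ) → f k = 0 := by
        intro k hk
        by_contra hne
        exact hg ⟨k, by simp only [g, hk, if_false]; omega⟩
      refine ⟨x, by omega, ?_⟩
      have hin : inflow f x = 0 := by
        simp only [inflow]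
        split_ifs with h0 h1
        · simp [hz (x + 1) (by omega)]
        · simp [hz 0 (by omega), hz (x + 1) (by omega)]
        · simp [hz (x - 1) (by omega), hz (x + 1) (by omega)]
      omega

theorem noForbidden_of_one_le (h : ∀ y : Fin (n + 1), (y : ℕ) < n → 1 ≤ η y) :
    NoForbidden n η := by
  intro f hf ⟨k, hk⟩
  by_contra! hcon
  have hlt : ∀ y < n, 2 * f y ≤ inflow f y := by
    intro y hy
    rcases Nat.eq_zero_or_pos (f y) with h0 | h0
    · omega
    · have h1 := hcon ⟨y, by omega⟩ h0
      have h2 := h ⟨y, by omega⟩ hy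
      simp only at h1
      omega
  have hlast : 2 * f n ≤ inflow f n + 1 := by
    rcases Nat.eq_zero_or_pos (f n) with h0 | h0
    · omega
    · have h1 := hcon ⟨n, by omega⟩ h0
      simp only at h1
      omega
  have hstep : ∀ y < n, f y ≤ f (y + 1) ∧ (f (y + 1) = 1 → f y = 0) := by
    intro y
    induction y with
    | zero =>
      intro hy
      have h0 := hlt 0 hy
      simp only [inflow, if_true] at h0
      constructor <;> grind
    | succ y ih =>
      intro hy
      have h0 := hlt 0 (by omega)
      have h1 := hlt (y + 1) hy
      have h2 := ih (by omega)
      simp only [inflow, if_true] at h0 h1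
      rcases Nat.eq_zero_or_pos y with rfl | hy0
      · simp at h0 h1 h2 ⊢
        omega
      · rw [if_neg (by omega), if_neg (by omega), Nat.add_sub_cancel] at h1
        omega
  have hmono : ∀ m, k ≤ m → m ≤ n → 0 < f m := by
    intro m hm
    induction m, hm using Nat.le_induction with
    | base => exact fun _ => hk
    | succ m _ ih =>
      intro hmn
      have := ih (by omega)
      have := (hstep m (by omega)).1
      omega
  have hkn : k ≤ n := by
    by_contra hne
    have := hf k (by omega)
    omega
  have hn := hmono n hkn le_rfl
  have hn1 := hf (n + 1) (by omega)
  rcases n with _ | m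
  · simp [inflow, hn1] at hlast
    omega
  · have h1 := hstep m (by omega)
    have h0 := hlt 0 (by omega)
    simp only [inflow, if_true, hn1] at hlast h0
    rcases Nat.eq_zero_or_pos m with rfl | hm
    · simp only [zero_add, if_true, one_ne_zero, if_false] at hlast h0 h1 hn
      omega
    · rw [if_neg (by omega), if_neg (by omega), Nat.add_sub_cancel] at hlast
      omega

theorem NoForbidden.one_le_of_stable (h : NoForbidden n ξ) (hs : Stable n ξ)
    (x : Fin (n + 1)) (hx : (x : ℕ) < n) : 1 ≤ ξ x := by
  by_contra hne
  have hx0 : ξ x = 0 := by omega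
  obtain ⟨y, hy, hle⟩ := h
    (fun k => if k = 0 then 1 else if k ≤ x then 2 else if k = x + 1 then 1 else 0)
    (fun y hy => by
      rw [if_neg (by omega), if_neg (by omega), if_neg (by omega)]) ⟨0, by simp⟩
  have hsy := hs y
  by_cases hyx : y = x
  · subst hyx
    simp only [inflow] at hle hy
    split_ifs at hle hy <;> omega
  · have : (y : ℕ) ≠ x := fun h => hyx (Fin.ext h)
    simp only [inflow] at hle hy
    split_ifs at hle hy <;> omega

theorem sum_mul_ite_val_eq (w : ℕ → ℤ) (hw : w (n + 1) = 0) (c : ℤ) {k : ℕ} (hk : k ≤ n + 1) :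
    ∑ y : Fin (n + 1), w y * (if (y : ℕ) = k then c else 0) = w k * c := by
  rw [Fin.sum_univ_eq_sum_range (fun y => w y * (if y = k then c else 0)) (n + 1)]
  simp only [mul_ite, mul_zero, Finset.sum_ite_eq', Finset.mem_range]
  split_ifs with h
  · rfl
  · obtain rfl : k = n + 1 := by omega
    simp [hw]

theorem sum_mul_topple (hζ0 : ζ 0 = Label.r) (hζ : ∀ x, x ≠ 0 → ζ x = Label.s)
    (w : ℕ → ℤ) (hw : w (n + 1) = 0) {x : Fin (n + 1)} (hx : 2 ≤ η x) :
    ∑ y : Fin (n + 1), w y * (topple n ζ η x y : ℤ) = ∑ y : Fin (n + 1), w y * (η y : ℤ) - 2 * w x +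
      (if (x : ℕ) = 0 then 2 * w 1 else w (x - 1 : ℕ) + w (x + 1)) := by
  have hxn := x.isLt
  have hsub : ∀ y, ((η y - if y = x then 2 else 0 : ℕ) : ℤ) =
      η y - if (y : ℕ) = x then 2 else 0 := by
    intro y
    by_cases hyx : y = x
    · subst hyx; simp; omega
    · have : (y : ℕ) ≠ x := fun h => hyx (Fin.ext h)
      simp [hyx, this]
  by_cases h0 : x = 0
  · subst h0
    have key : ∀ y, (topple n ζ η 0 y : ℤ) = η y - (if (y : ℕ) = 0 then 2 else 0) +
        (if (y : ℕ) = 1 then 2 else 0) := by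
      intro y
      have := hsub y
      simp only [topple, hζ0]
      push_cast at this ⊢
      rw [this]
      simp
    simp only [key, mul_add, mul_sub, Finset.sum_add_distrib, Finset.sum_sub_distrib]
    rw [sum_mul_ite_val_eq w hw 2 (by omega), sum_mul_ite_val_eq w hw 2 (by omega)]
    simp
    ring
  · have hx0 : (x : ℕ) ≠ 0 := fun h => h0 (Fin.ext h)
    have key : ∀ y, (topple n ζ η x y : ℤ) = η y - (if (y : ℕ) = x then 2 else 0) +
        (if (y : ℕ) = x - 1 then 1 else 0) + (if (y : ℕ) = x + 1 then 1 else 0) := by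
      intro y
      have := hsub y
      have hiff : (y : ℕ) + 1 = x ↔ (y : ℕ) = x - 1 := by omega
      simp only [topple, hζ x h0, hiff]
      push_cast at this ⊢
      rw [this]
      simp
    simp only [key, mul_add, mul_sub, Finset.sum_add_distrib, Finset.sum_sub_distrib]
    rw [sum_mul_ite_val_eq w hw 2 (by omega), sum_mul_ite_val_eq w hw 1 (by omega),
      sum_mul_ite_val_eq w hw 1 (by omega), if_neg hx0]
    ring

theorem exists_stabilizesTo (hζ0 : ζ 0 = Label.r) (hζ : ∀ x, x ≠ 0 → ζ x = Label.s)
    (η : Fin (n + 1) → ℕ) : ∃ ξ, StabilizesTo n ζ η ξ := by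
  let w : ℕ → ℤ := fun y => (n + 1) ^ 2 - y ^ 2
  induction hV : (∑ y : Fin (n + 1), w y * (η y : ℤ)).toNat using Nat.strong_induction_on generalizing η with
  | _ N ih =>
    by_cases hs : Stable n η
    · exact ⟨η, Relation.ReflTransGen.refl, hs⟩
    · simp only [Stable, not_forall, not_le] at hs
      obtain ⟨x, hx⟩ := hs
      have hx' : 2 ≤ η x := hx
      have hnonneg : ∀ θ : Fin (n + 1) → ℕ, 0 ≤ ∑ y : Fin (n + 1), w y * (θ y : ℤ) := by
        intro θ
        refine Finset.sum_nonneg fun y _ => mul_nonneg ?_ (by positivity)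
        have : ((y : ℕ) : ℤ) ≤ n + 1 := by have := y.isLt; omega
        simp only [w]
        nlinarith
      have hsum := sum_mul_topple hζ0 hζ w (by simp [w]) hx'
      have hdrop : ∑ y : Fin (n + 1), w y * (topple n ζ η x y : ℤ) = ∑ y : Fin (n + 1), w y * (η y : ℤ) - 2 := by
        rw [hsum]
        split_ifs with h0
        · simp only [w, h0]; push_cast; ring
        · simp only [w]
          rw [Nat.cast_sub (by omega)]
          push_cast
          ring
      obtain ⟨ξ, hξ, hst⟩ := ih _ (by
        have := hnonneg η
        have := hnonneg (topple n ζ η x)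
        omega) (topple n ζ η x) rfl
      exact ⟨ξ, Relation.ReflTransGen.head ⟨x, hx', rfl⟩ hξ, hst⟩

theorem noForbidden_and_sum_emod_two_of_reflTransGen (hζ0 : ζ 0 = Label.r)
    (hζ : ∀ x, x ≠ 0 → ζ x = Label.s) (h : NoForbidden n η)
    (hr : Relation.ReflTransGen (LegalStep n ζ) η ξ) :
    NoForbidden n ξ ∧ (∑ y : Fin (n + 1), ((n : ℤ) + 1 - (y : ℕ)) * (ξ y : ℤ)) % 2 =
      (∑ y : Fin (n + 1), ((n : ℤ) + 1 - (y : ℕ)) * (η y : ℤ)) % 2 := by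
  induction hr with
  | refl => exact ⟨h, rfl⟩
  | tail _ hstep ih =>
    obtain ⟨x, hx, rfl⟩ := hstep
    refine ⟨ih.1.topple hζ0 hζ hx, ?_⟩
    rw [sum_mul_topple hζ0 hζ (fun y => (n : ℤ) + 1 - (y : ℕ)) (by simp) hx, ← ih.2]
    split_ifs <;> omega

theorem sum_mul_eq_of_eq_one {θ : Fin (n + 1) → ℕ} (h : ∀ y : Fin (n + 1), (y : ℕ) < n → θ y = 1) :
    ∑ y : Fin (n + 1), ((n : ℤ) + 1 - (y : ℕ)) * (θ y : ℤ) =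
      ∑ y : Fin n, ((n : ℤ) + 1 - (y : ℕ)) + θ (Fin.last n) := by
  rw [Fin.sum_univ_castSucc]
  simp [fun y : Fin n => h y.castSucc y.isLt]

theorem sum_mul_addAt (a : Fin (n + 1)) (η : Fin (n + 1) → ℕ) :
    ∑ y : Fin (n + 1), ((n : ℤ) + 1 - (y : ℕ)) * (addAt n a η y : ℤ) =
      ∑ y : Fin (n + 1), ((n : ℤ) + 1 - (y : ℕ)) * (η y : ℤ) + ((n : ℤ) + 1 - (a : ℕ)) := by
  have key : ∀ y, (addAt n a η y : ℤ) = η y + if y = a then 1 else 0 := by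
    intro y
    by_cases hy : y = a
    · subst hy; simp [addAt]
    · simp [addAt, hy]
  simp [key, mul_add, Finset.sum_add_distrib]

theorem eq_of_last_eq {θ : Fin (n + 1) → ℕ} (hη : ∀ y : Fin (n + 1), (y : ℕ) < n → η y = 1)
    (hθ : ∀ y : Fin (n + 1), (y : ℕ) < n → θ y = 1) (hl : η (Fin.last n) = θ (Fin.last n)) :
    η = θ := by
  funext y
  rcases Fin.eq_castSucc_or_eq_last y with ⟨z, rfl⟩ | rfl
  · rw [hη _ z.isLt, hθ _ z.isLt]
  · exact hl

end Driven

open Driven in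
/-- Lemma 5.1: on `I_n` with `ζ 0 = r` and `ζ x = s` for `x ≠ 0`,
for `η ∈ {η_f, η_e}` and any addition site `a`, adding one particle at `a` and
stabilizing yields `η` itself if `n - a` is odd, and the other element of
`{η_f, η_e}` if `n - a` is even.  In particular `{η_f, η_e}` is absorbing. -/
theorem absorbing_pair (n : ℕ) (ζ : Fin (n + 1) → Label)
    (hζ0 : ζ 0 = Label.r) (hζ : ∀ x : Fin (n + 1), x ≠ 0 → ζ x = Label.s)
    (η : Fin (n + 1) → ℕ) (hη : η = etaF n ∨ η = etaE n) (a : Fin (n + 1)) :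
    (∃ ξ, StabilizesTo n ζ (addAt n a η) ξ) ∧
    ∀ ξ, StabilizesTo n ζ (addAt n a η) ξ →
      ξ = if (n - (a : ℕ)) % 2 = 1 then η
          else if η = etaF n then etaE n else etaF n := by
  have hF : ∀ y : Fin (n + 1), (y : ℕ) < n → etaF n y = 1 := fun _ _ => rfl
  have hE : ∀ y : Fin (n + 1), (y : ℕ) < n → etaE n y = 1 := fun y hy => if_neg hy.ne
  have hFl : etaF n (Fin.last n) = 1 := rfl
  have hEl : etaE n (Fin.last n) = 0 := if_pos rfl
  have hEF : etaE n ≠ etaF n := fun h => by rw [h, hFl] at hEl; omega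
  have hη1 : ∀ y : Fin (n + 1), (y : ℕ) < n → η y = 1 := by
    rcases hη with rfl | rfl
    exacts [hF, hE]
  refine ⟨exists_stabilizesTo hζ0 hζ _, fun ξ ⟨hr, hs⟩ => ?_⟩
  have hadd : NoForbidden n (addAt n a η) := by
    refine noForbidden_of_one_le fun y hy => ?_
    by_cases hya : y = a
    · subst hya; simp [addAt]
    · simp [addAt, hya, hη1 y hy]
  obtain ⟨hnf, hpar⟩ := noForbidden_and_sum_emod_two_of_reflTransGen hζ0 hζ hadd hr
  have hξ1 : ∀ y : Fin (n + 1), (y : ℕ) < n → ξ y = 1 := fun y hy =>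
    le_antisymm (hs y) (hnf.one_le_of_stable hs y hy)
  rw [sum_mul_addAt, sum_mul_eq_of_eq_one hξ1, sum_mul_eq_of_eq_one hη1] at hpar
  have hξl := hs (Fin.last n)
  have han := a.isLt
  rcases hη with rfl | rfl
  · split_ifs with hodd
    · exact eq_of_last_eq hξ1 hF (by omega)
    · exact eq_of_last_eq hξ1 hE (by omega)
    · contradiction
  · rw [if_neg hEF]
    split_ifs with hodd
    · exact eq_of_last_eq hξ1 hE (by omega)
    · exact eq_of_last_eq hξ1 hF (by omega)
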